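/- Assume the Bethe ansatz equations (BAE)_ν hold for all ν with 1 ≤ ν ≤ n−1 and all roots s^{(ν)}_i of y_ν. Then for every 0 ≤ k ≤ n the rational function a_k(x) = a_0(x) t_k(x) is a polynomial. -/

import Mathlib

open Polynomial Finset
open scoped Classical

noncomputable section

/-- The rational function `x ↦ p (c * x)` associated with a polynomial `p`. -/
def pshift (c : ℂ) (p : Polynomial ℂ) : RatFunc ℂ :=
  algebraMap (Polynomial ℂ) (RatFunc ℂ) (p.comp (C c * X))

/-- The rational function `x ↦ f (c * x)`. -/
def qshift (c : ℂ) (f : RatFunc ℂ) : RatFunc ℂ :=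
  algebraMap (Polynomial ℂ) (RatFunc ℂ) (f.num.comp (C c * X)) /
    algebraMap (Polynomial ℂ) (RatFunc ℂ) (f.denom.comp (C c * X))

/-- `y_ν(x) = ∏_i (x − s^{(ν)}_i)`. -/
def yP (n : ℕ) (l : ZMod n → ℕ) (s : (ν : ZMod n) → Fin (l ν) → ℂ) (ν : ZMod n) :
    Polynomial ℂ :=
  ∏ i : Fin (l ν), (X - C (s ν i))

/-- `Ψ̃_ν(c x) = G_ν(c x)/F_ν(c x)` as a rational function. -/
def psiR (n : ℕ) (F G : ZMod n → Polynomial ℂ) (ν : ZMod n) (c : ℂ) : RatFunc ℂ :=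
  pshift c (G ν) / pshift c (F ν)

/-- The rational functions `b_i(x)`, `1 ≤ i ≤ n` (indices of `y` taken mod `n`). -/
def bf (n : ℕ) (q1 q2 q3 : ℂ) (l : ZMod n → ℕ) (s : (ν : ZMod n) → Fin (l ν) → ℂ)
    (F G : ZMod n → Polynomial ℂ) (i : ℕ) : RatFunc ℂ :=
  if i = 1 then
    pshift q2 (yP n l s 1) / algebraMap (Polynomial ℂ) (RatFunc ℂ) (yP n l s 1)
  else
    (∏ ν ∈ Finset.Icc 1 (i - 1), psiR n F G (ν : ZMod n) (q1 ^ (ν - 1) * q2 ^ (i - 1)))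
      * (pshift (q3 ^ ((2 : ℤ) - (i : ℤ))) (yP n l s ((i : ZMod n) - 1)) /
          pshift (q3 ^ ((2 : ℤ) - (i : ℤ)) * q2) (yP n l s ((i : ZMod n) - 1)))
      * (pshift (q3 ^ ((1 : ℤ) - (i : ℤ)) * q2) (yP n l s (i : ZMod n)) /
          pshift (q3 ^ ((1 : ℤ) - (i : ℤ))) (yP n l s (i : ZMod n)))
      * (pshift (q3 * q2 ^ i) (yP n l s 0) / pshift (q3 * q2 ^ (i - 1)) (yP n l s 0))

/-- `t_k(x) = ∑_{1≤i_1<⋯<i_k≤n} ∏_p b_{i_p}(q_2^{n−i_p−k+p} x)`. -/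
def tf (n : ℕ) (q1 q2 q3 : ℂ) (l : ZMod n → ℕ) (s : (ν : ZMod n) → Fin (l ν) → ℂ)
    (F G : ZMod n → Polynomial ℂ) (k : ℕ) : RatFunc ℂ :=
  ∑ v ∈ Finset.univ.filter (fun v : Fin k → Fin n => StrictMono v),
    ∏ p : Fin k,
      qshift (q2 ^ ((n : ℤ) - (((v p : ℕ) : ℤ) + 1) - (k : ℤ) + (((p : ℕ) : ℤ) + 1)))
        (bf n q1 q2 q3 l s F G ((v p : ℕ) + 1))

/-- The leading coefficient
`a_0(x) = ∏_{1≤ν<i≤n} F_ν(q_1^{ν−1}q_2^{i−1}x) · ∏_{j=1}^{n−1} y_0(q_3 q_2^j x) · y_0(q_3^{1−n} x)`. -/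
def a0R (n : ℕ) (q1 q2 q3 : ℂ) (l : ZMod n → ℕ) (s : (ν : ZMod n) → Fin (l ν) → ℂ)
    (F : ZMod n → Polynomial ℂ) : RatFunc ℂ :=
  (∏ p ∈ ((Finset.Icc 1 n) ×ˢ (Finset.Icc 1 n)).filter (fun p => p.1 < p.2),
      pshift (q1 ^ (p.1 - 1) * q2 ^ (p.2 - 1)) (F (p.1 : ZMod n)))
    * (∏ j ∈ Finset.Icc 1 (n - 1), pshift (q3 * q2 ^ j) (yP n l s 0))
    * pshift (q3 ^ ((1 : ℤ) - (n : ℤ))) (yP n l s 0)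

/-- `a_k(x) = a_0(x) t_k(x)`. -/
def aR (n : ℕ) (q1 q2 q3 : ℂ) (l : ZMod n → ℕ) (s : (ν : ZMod n) → Fin (l ν) → ℂ)
    (F G : ZMod n → Polynomial ℂ) (k : ℕ) : RatFunc ℂ :=
  a0R n q1 q2 q3 l s F * tf n q1 q2 q3 l s F G k

/-- The Bethe ansatz equation (BAE)_ν at the point `z`. -/
def BAE (n : ℕ) (q1 q2 q3 : ℂ) (l : ZMod n → ℕ) (s : (ν : ZMod n) → Fin (l ν) → ℂ)
    (F G : ZMod n → Polynomial ℂ) (ν : ZMod n) (z : ℂ) : Prop :=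
  ((yP n l s ν).eval (q2 * z) / (yP n l s ν).eval (q2⁻¹ * z))
    * ((yP n l s (ν - 1)).eval (q3 * z) / (yP n l s (ν - 1)).eval (q1⁻¹ * z))
    * ((yP n l s (ν + 1)).eval (q1 * z) / (yP n l s (ν + 1)).eval (q3⁻¹ * z))
  = -((G ν).eval z / (F ν).eval z)


/-- Weighted count of lattice paths starting at position `s` with weight `e`: at the `i`-th step
the path either stays at its position `j`, or moves to `j + 1` with weight `d i j`. -/
def pathSum {K : Type*} [CommRing K] (d : ℕ → ℤ → K) (e : K) (s : ℤ) : ℕ → ℤ → K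
  | 0, j => if j = s then e else 0
  | i + 1, j => pathSum d e s i j + pathSum d e s i (j - 1) * d i (j - 1)

lemma pathSum_succ {K : Type*} [CommRing K] (d : ℕ → ℤ → K) (e : K) (s : ℤ) (i : ℕ) (j : ℤ) :
    pathSum d e s (i + 1) j = pathSum d e s i j + pathSum d e s i (j - 1) * d i (j - 1) := rfl

lemma pathSum_eq_zero_of_lt {K : Type*} [CommRing K] (d : ℕ → ℤ → K) (e : K) (s : ℤ) (i : ℕ)
    {j : ℤ} (hj : j < s) : pathSum d e s i j = 0 := by
  induction i generalizing j with
  | zero => simp [pathSum, hj.ne]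
  | succ i ih => rw [pathSum_succ, ih hj, ih (by omega)]; simp

lemma pathSum_self {K : Type*} [CommRing K] (d : ℕ → ℤ → K) (e : K) (s : ℤ) (i : ℕ) :
    pathSum d e s i s = e := by
  induction i with
  | zero => simp [pathSum]
  | succ i ih => rw [pathSum_succ, ih, pathSum_eq_zero_of_lt d e s i (by omega)]; simp

lemma pathSum_eq_zero_of_gt {K : Type*} [CommRing K] (d : ℕ → ℤ → K) (e : K) (s : ℤ) (i : ℕ)
    {j : ℤ} (hj : s + i < j) : pathSum d e s i j = 0 := by
  induction i generalizing j with
  | zero => simp [pathSum, show j ≠ s by simp at hj; omega]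
  | succ i ih =>
    push_cast at hj
    rw [pathSum_succ, ih (by omega), ih (by omega)]; simp

lemma pathSum_one {K : Type*} [CommRing K] (d : ℕ → ℤ → K) (e : K) (s j : ℤ) :
    pathSum d e s 1 j = (if j = s then e else 0) + (if j = s + 1 then e * d 0 s else 0) := by
  rw [pathSum_succ]
  simp only [pathSum]
  by_cases h : j = s + 1
  · subst h; simp
  · simp [h, show j - 1 ≠ s by omega]

/-- Rescaling the weights by a coboundary. -/
lemma pathSum_gauge {K : Type*} [Field K] (d d' : ℕ → ℤ → K) (h : ℤ → K) (e : K) (s : ℤ)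
    (hh : ∀ j, h j ≠ 0) (hd : ∀ i j, s ≤ j → d' i j = d i j * (h (j + 1) / h j)) (i : ℕ) (j : ℤ) :
    pathSum d' e s i j = e * (h j / h s) * pathSum d 1 s i j := by
  induction i generalizing j with
  | zero =>
    by_cases hj : j = s
    · subst hj; simp [pathSum, hh]
    · simp [pathSum, hj]
  | succ i ih =>
    rw [pathSum_succ, pathSum_succ, ih, ih]
    rcases lt_or_ge (j - 1) s with hj | hj
    · rw [pathSum_eq_zero_of_lt d 1 s i hj]; ring
    · rw [hd _ _ hj, sub_add_cancel]
      have h1 := hh (j - 1)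
      have h2 := hh s
      field_simp

/-- The sum over strictly increasing sequences is a path sum. -/
lemma sum_strictMono_eq_pathSum {K : Type*} [CommRing K] (d : ℕ → ℤ → K) (s : ℤ) (n k : ℕ) :
    ∑ v ∈ Finset.univ.filter (fun v : Fin k → Fin n => StrictMono v),
      ∏ p : Fin k, d (v p) (s + (p : ℕ)) = pathSum d 1 s n (s + k) := by
  induction n generalizing k with
  | zero =>
    cases k with
    | zero =>
      simp [pathSum, Subsingleton.strictMono]
    | succ k =>
      simp only [pathSum]
      rw [if_neg (by push_cast; omega)]
      exact Finset.sum_eq_zero (fun v _ => (v 0).elim0)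
  | succ n ih =>
    cases k with
    | zero =>
      simp [pathSum_self, Subsingleton.strictMono]
    | succ k =>
      rw [pathSum_succ, ← ih, show s + ((k + 1 : ℕ) : ℤ) - 1 = s + k by push_cast; ring, ← ih,
        ← Finset.sum_filter_add_sum_filter_not _ (fun v => v (Fin.last k) ≠ Fin.last n)]
      congr 1
      · symm
        refine Finset.sum_bij (fun v _ => fun p => (v p).castSucc) ?_ ?_ ?_ ?_
        · intro v hv
          simp only [Finset.mem_filter, Finset.mem_univ, true_and] at hv ⊢
          exact ⟨fun a b hab => Fin.castSucc_lt_castSucc_iff.2 (hv hab), Fin.castSucc_ne_last _⟩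
        · intro v _ w _ hvw
          funext p
          exact Fin.castSucc_injective _ (congrFun hvw p)
        · intro v hv
          simp only [Finset.mem_filter, Finset.mem_univ, true_and] at hv
          have hne : ∀ p, v p ≠ Fin.last n := fun p hp => by
            have h1 := hv.1.monotone (Fin.le_last p)
            rw [hp] at h1
            exact hv.2 (le_antisymm (Fin.le_last _) h1)
          refine ⟨fun p => (v p).castPred (hne p), ?_, ?_⟩
          · simp only [Finset.mem_filter, Finset.mem_univ, true_and]
            intro a b hab
            exact Fin.castPred_lt_castPred_iff.2 (hv.1 hab)
          · funext p; simp
        · intro v _; simp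
      · rw [Finset.sum_mul]
        symm
        refine Finset.sum_bij
          (fun v _ => Fin.snoc (α := fun _ => Fin (n + 1)) (fun p => (v p).castSucc) (Fin.last n))
          ?_ ?_ ?_ ?_
        · intro v hv
          simp only [Finset.mem_filter, Finset.mem_univ, true_and] at hv ⊢
          refine ⟨?_, by simp⟩
          intro a b hab
          induction b using Fin.lastCases with
          | last =>
            induction a using Fin.lastCases with
            | last => exact absurd hab (lt_irrefl _)
            | cast a => simp [Fin.castSucc_lt_last]
          | cast b =>
            induction a using Fin.lastCases with
            | last => exact absurd hab (not_lt.2 (Fin.le_last _))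
            | cast a => simpa using hv (Fin.castSucc_lt_castSucc_iff.1 hab)
        · intro v _ w _ hvw
          funext p
          simpa using congrFun hvw p.castSucc
        · intro v hv
          simp only [Finset.mem_filter, Finset.mem_univ, true_and, not_not] at hv
          have hne : ∀ p : Fin k, v p.castSucc ≠ Fin.last n := fun p hp => by
            have h1 := hv.1 (Fin.castSucc_lt_last p)
            rw [hp] at h1
            exact absurd h1 (not_lt.2 (Fin.le_last _))
          refine ⟨fun p => (v p.castSucc).castPred (hne p), ?_, ?_⟩
          · simp only [Finset.mem_filter, Finset.mem_univ, true_and]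
            intro a b hab
            exact Fin.castPred_lt_castPred_iff.2 (hv.1 (Fin.castSucc_lt_castSucc_iff.2 hab))
          · funext p
            induction p using Fin.lastCases with
            | last => simp [hv.2]
            | cast p => simp
        · intro v _
          rw [Fin.prod_univ_castSucc]
          simp

section Regularity

variable {K : Type*} [Field K] (O : Subring K) (n : ℕ) (z P : ℕ → ℤ → K)

/-- Weights of the path sum for the monodromy data `z` and scalar parts `P`. -/
def stepWeight (i : ℕ) (j : ℤ) : K :=
  P i j * (z i (j - 1) / z i j) * (z (i + 1) (j + 1) / z (i + 1) j)

/-- Along the diagonal the path sum telescopes. -/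
lemma pathSum_diagonal (hz0 : ∀ i j, z i j ≠ 0)
    (hP : ∀ (i : ℕ) (j : ℤ), (i : ℤ) ≤ j → P i j ∈ O) (e : K)
    (he : e * (z 0 (-1) / z 0 0) ∈ O) (i : ℕ) :
    ∃ Q ∈ O, pathSum (stepWeight z P) e 0 (i + 1) ((i : ℤ) + 1) =
      Q * (z (i + 1) (i + 1) / z (i + 1) i) := by
  induction i with
  | zero =>
    refine ⟨e * (z 0 (-1) / z 0 0) * P 0 0, O.mul_mem he (hP 0 0 le_rfl), ?_⟩
    rw [pathSum_one]
    simp [stepWeight]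
    ring
  | succ i ih =>
    obtain ⟨Q, hQ, h⟩ := ih
    refine ⟨Q * P (i + 1) (i + 1), O.mul_mem hQ (hP _ _ (by push_cast; rfl)), ?_⟩
    rw [pathSum_succ, pathSum_eq_zero_of_gt _ _ _ _ (by push_cast; omega)]
    push_cast
    rw [add_sub_cancel_right, h, stepWeight, add_sub_cancel_right]
    have h1 := hz0 (i + 1) i
    have h2 := hz0 (i + 1) (i + 1)
    have h3 := hz0 (i + 2) (i + 1)
    field_simp
    ring_nf

/-- If no `z i j` with `0 < i < n` vanishes, every path is regular. -/
lemma pathSum_mem_of_units (hn : 2 ≤ n) (hz : ∀ i j, z i j ∈ O) (hz0 : ∀ i j, z i j ≠ 0)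
    (hP : ∀ (i : ℕ) (j : ℤ), (i : ℤ) ≤ j → P i j ∈ O)
    (hu : ∀ i j, i + 1 < n → (z (i + 1) j)⁻¹ ∈ O) (e : K) (s : ℤ) (hs : 0 ≤ s) (he : e ∈ O)
    (he' : e * (z 0 (s - 1) / z 0 s) ∈ O) :
    z n (n - 1) * pathSum (stepWeight z P) e s n n ∈ O := by
  have key : ∀ i, i + 1 < n → ∀ j : ℤ, (i : ℤ) + 1 ≤ j →
      pathSum (stepWeight z P) e s (i + 1) j ∈ O := by
    intro i
    induction i with
    | zero =>
      intro hi j hj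
      rw [pathSum_one]
      refine O.add_mem ?_ ?_
      · split_ifs
        exacts [he, O.zero_mem]
      · split_ifs
        · have : e * stepWeight z P 0 s = e * (z 0 (s - 1) / z 0 s) * P 0 s *
              (z 1 (s + 1) * (z 1 s)⁻¹) := by
            simp only [stepWeight]; ring
          rw [this]
          exact O.mul_mem (O.mul_mem he' (hP _ _ (by simpa using hs)))
            (O.mul_mem (hz _ _) (hu 0 _ hi))
        · exact O.zero_mem
    | succ i ih =>
      intro hi j hj
      push_cast at hj
      rw [pathSum_succ]
      refine O.add_mem (ih (by omega) _ (by omega)) (O.mul_mem (ih (by omega) _ (by omega)) ?_)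
      simp only [stepWeight, div_eq_mul_inv]
      exact O.mul_mem (O.mul_mem (hP _ _ (by push_cast; omega))
        (O.mul_mem (hz _ _) (hu _ _ (by omega)))) (O.mul_mem (hz _ _) (hu _ _ (by omega)))
  obtain ⟨m, rfl⟩ : ∃ m, n = m + 2 := ⟨n - 2, by omega⟩
  rw [pathSum_succ, mul_add]
  push_cast
  refine O.add_mem (O.mul_mem (hz _ _) (key m (by omega) _ (by omega))) ?_
  have h1 := key m (by omega) ((m : ℤ) + 2 - 1) (by omega)
  have : z (m + 2) ((m : ℤ) + 2 - 1) * stepWeight z P (m + 1) ((m : ℤ) + 2 - 1) =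
      P (m + 1) (m + 2 - 1) * (z (m + 1) (m + 2 - 1 - 1) * (z (m + 1) (m + 2 - 1))⁻¹) *
        z (m + 2) (m + 2 - 1 + 1) := by
    have := hz0 (m + 2) ((m : ℤ) + 2 - 1)
    simp only [stepWeight]
    field_simp
  rw [mul_left_comm, this]
  exact O.mul_mem h1 (O.mul_mem (O.mul_mem (hP _ _ (by push_cast; omega))
    (O.mul_mem (hz _ _) (hu _ _ (by omega)))) (hz _ _))

/-- The inductive invariant: the only pole of `A` sits one step after a zero of `z (i + 1)`,
and its polar part is `A j * stepWeight z P i j`. -/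
def PoleControlled (i : ℕ) (A : ℤ → K) : Prop :=
  ∀ j, ((z (i + 1) j)⁻¹ ∈ O → A (j + 1) ∈ O) ∧
    ((z (i + 1) j)⁻¹ ∉ O → A (j + 1) - A j * stepWeight z P i j ∈ O)

variable (hz : ∀ i j, z i j ∈ O) (hz0 : ∀ i j, z i j ≠ 0) (hP : ∀ i j, P i j ∈ O)
  (hU : ∀ i j j', i + 1 < n → (z (i + 1) j)⁻¹ ∉ O → (z (i + 1) j')⁻¹ ∉ O → j = j')
  (hN : ∀ i j, i + 1 < n → (z (i + 1) j)⁻¹ ∉ O → (z i j)⁻¹ ∈ O ∧ (z i (j - 1))⁻¹ ∈ O)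

include hz hz0 hP hU hN

lemma poleControlled_pathSum_one (hn : 2 ≤ n) (e : K) (s : ℤ) (he : e ∈ O)
    (he' : e * (z 0 (s - 1) / z 0 s) ∈ O) :
    PoleControlled O z P 0 (pathSum (stepWeight z P) e s 1) := by
  intro j
  have e1 := hz0 0 s
  have e2 := hz0 0 (s + 1)
  have e3 := hz0 1 s
  have e4 := hz0 1 (s + 1)
  constructor
  · intro h
    rw [pathSum_one]
    refine O.add_mem ?_ ?_
    · split_ifs
      exacts [he, O.zero_mem]
    · split_ifs with hj
      · obtain rfl : j = s := by omega
        have : e * stepWeight z P 0 j = e * (z 0 (j - 1) / z 0 j) * P 0 j *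
            (z 1 (j + 1) * (z 1 j)⁻¹) := by
          simp only [stepWeight]; ring
        rw [this]
        exact O.mul_mem (O.mul_mem he' (hP _ _)) (O.mul_mem (hz _ _) h)
      · exact O.zero_mem
  · intro h
    rw [pathSum_one, pathSum_one]
    rcases eq_or_ne j s with rfl | h1
    · simp
    rcases eq_or_ne j (s + 1) with rfl | h2
    · have hs : (z 1 s)⁻¹ ∈ O := by
        by_contra h3
        have := hU 0 _ _ (by omega) h h3
        omega
      have : e * stepWeight z P 0 s * stepWeight z P 0 (s + 1) =
          e * z 0 (s - 1) * P 0 s * P 0 (s + 1) * (z 0 (s + 1))⁻¹ *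
            (z 1 (s + 1 + 1) * (z 1 s)⁻¹) := by
        simp only [stepWeight, add_sub_cancel_right, zero_add]
        field_simp
      simp only [one_ne_zero, if_false, if_true, add_eq_left, add_zero, zero_add]
      rw [this, if_neg (by omega), zero_sub]
      exact O.neg_mem (O.mul_mem (O.mul_mem (O.mul_mem (O.mul_mem (O.mul_mem he (hz _ _))
        (hP _ _)) (hP _ _)) (hN 0 _ (by omega) h).1) (O.mul_mem (hz _ _) hs))
    · rw [if_neg h1, if_neg h2, if_neg (show ¬ j + 1 = s + 1 by omega)]
      simp only [add_zero, zero_mul, sub_zero]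
      split_ifs
      exacts [he, O.zero_mem]

variable (hE : ∀ i j, i + 1 < n → (z (i + 1) j)⁻¹ ∉ O →
  stepWeight z P i j + stepWeight z P (i + 1) j ∈ O)

include hE

lemma PoleControlled.mul_step_mem {i : ℕ} (hi : i + 1 < n) {A : ℤ → K}
    (hA : PoleControlled O z P i A) (ζ : K) (hζ : ζ ∈ O) (j : ℤ)
    (hζj : ζ * (z (i + 2) (j + 1) / z (i + 2) j) ∈ O) :
    ζ * (A (j + 1) + A j * stepWeight z P (i + 1) j) ∈ O := by
  by_cases h0 : (z (i + 1) j)⁻¹ ∈ O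
  · have hd : ζ * stepWeight z P (i + 1) j ∈ O := by
      have : ζ * stepWeight z P (i + 1) j = P (i + 1) j * (z (i + 1) (j - 1) * (z (i + 1) j)⁻¹) *
          (ζ * (z (i + 2) (j + 1) / z (i + 2) j)) := by
        simp only [stepWeight]; ring
      rw [this]
      exact O.mul_mem (O.mul_mem (hP _ _) (O.mul_mem (hz _ _) h0)) hζj
    rw [mul_add]
    refine O.add_mem (O.mul_mem hζ ((hA j).1 h0)) ?_
    have hj := hA (j - 1)
    rw [sub_add_cancel] at hj
    by_cases h1 : (z (i + 1) (j - 1))⁻¹ ∈ O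
    · rw [mul_left_comm]
      exact O.mul_mem (hj.1 h1) hd
    · have hA2 : A (j - 1) ∈ O := by
        have := (hA (j - 2)).1 (by
          by_contra h2
          have := hU i _ _ hi h1 h2
          omega)
        rwa [show j - 2 + 1 = j - 1 by ring] at this
      have : ζ * (A j * stepWeight z P (i + 1) j) =
          (A j - A (j - 1) * stepWeight z P i (j - 1)) * (ζ * stepWeight z P (i + 1) j) +
          A (j - 1) * (P i (j - 1) * P (i + 1) j * (z i (j - 1 - 1) * (z i (j - 1))⁻¹) *
            (ζ * (z (i + 2) (j + 1) / z (i + 2) j))) := by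
        have e1 := hz0 (i + 1) (j - 1)
        have e2 := hz0 (i + 1) j
        have e3 := hz0 i (j - 1)
        have e4 := hz0 (i + 2) j
        simp only [stepWeight, sub_add_cancel]
        field_simp
        ring
      rw [this]
      exact O.add_mem (O.mul_mem (hj.2 h1) hd) (O.mul_mem hA2 (O.mul_mem (O.mul_mem
        (O.mul_mem (hP _ _) (hP _ _)) (O.mul_mem (hz _ _) (hN i _ hi h1).1)) hζj))
  · have hA1 : A j ∈ O := by
      have := (hA (j - 1)).1 (by
        by_contra h2
        have := hU i _ _ hi h0 h2
        omega)
      rwa [sub_add_cancel] at this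
    have : A (j + 1) + A j * stepWeight z P (i + 1) j =
        (A (j + 1) - A j * stepWeight z P i j) +
          A j * (stepWeight z P i j + stepWeight z P (i + 1) j) := by ring
    rw [this]
    exact O.mul_mem hζ (O.add_mem ((hA j).2 h0) (O.mul_mem hA1 (hE i j hi h0)))

lemma PoleControlled.succ {i : ℕ} (hi : i + 2 < n) {A : ℤ → K}
    (hA : PoleControlled O z P i A) :
    PoleControlled O z P (i + 1)
      (fun j => A j + A (j - 1) * stepWeight z P (i + 1) (j - 1)) := by
  intro j
  constructor
  · intro h
    have := hA.mul_step_mem O n z P hz hz0 hP hU hN hE (by omega) 1 O.one_mem j (by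
      rw [one_mul, div_eq_mul_inv]; exact O.mul_mem (hz _ _) h)
    simpa using this
  · intro h
    have hd1 : (z (i + 2) (j - 1))⁻¹ ∈ O := by
      by_contra h2
      have := hU (i + 1) _ _ (by omega) h h2
      omega
    obtain ⟨hn1, hn2⟩ := hN (i + 1) j (by omega) h
    have hw : P (i + 1) (j - 1) * P (i + 1) j * (z (i + 2) (j + 1) * (z (i + 2) (j - 1))⁻¹) *
        (z (i + 1) j)⁻¹ ∈ O :=
      O.mul_mem (O.mul_mem (O.mul_mem (hP _ _) (hP _ _)) (O.mul_mem (hz _ _) hd1)) hn1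
    have e1 := hz0 (i + 1) (j - 1)
    have e2 := hz0 (i + 1) j
    have e3 := hz0 (i + 2) (j - 1)
    have e4 := hz0 (i + 2) j
    have hdd : stepWeight z P (i + 1) (j - 1) * stepWeight z P (i + 1) j =
        z (i + 1) (j - 1 - 1) *
        (P (i + 1) (j - 1) * P (i + 1) j * (z (i + 2) (j + 1) * (z (i + 2) (j - 1))⁻¹) *
        (z (i + 1) j)⁻¹) := by
      simp only [stepWeight, sub_add_cancel]
      field_simp
    have : A (j + 1) + A (j + 1 - 1) * stepWeight z P (i + 1) (j + 1 - 1) -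
        (A j + A (j - 1) * stepWeight z P (i + 1) (j - 1)) * stepWeight z P (i + 1) j =
        A (j + 1) - A (j - 1) *
          (stepWeight z P (i + 1) (j - 1) * stepWeight z P (i + 1) j) := by
      rw [add_sub_cancel_right]; ring
    simp only
    rw [this]
    refine O.sub_mem ((hA j).1 hn1) ?_
    rw [hdd]
    have hj := hA (j - 1 - 1)
    rw [sub_add_cancel] at hj
    by_cases h1 : (z (i + 1) (j - 1 - 1))⁻¹ ∈ O
    · exact O.mul_mem (hj.1 h1) (O.mul_mem (hz _ _) hw)
    · have hA2 : A (j - 1 - 1) ∈ O := by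
        have := (hA (j - 1 - 1 - 1)).1 (by
          by_contra h2
          have := hU i _ _ (by omega) h1 h2
          omega)
        rwa [sub_add_cancel] at this
      have e5 := hz0 (i + 1) (j - 1 - 1)
      have e6 := hz0 i (j - 1 - 1)
      have hd3 : stepWeight z P i (j - 1 - 1) * z (i + 1) (j - 1 - 1) =
          P i (j - 1 - 1) * (z i (j - 1 - 1 - 1) * (z i (j - 1 - 1))⁻¹) * z (i + 1) (j - 1) := by
        simp only [stepWeight, sub_add_cancel]
        field_simp
      rw [← mul_assoc, show A (j - 1) * z (i + 1) (j - 1 - 1) =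
        (A (j - 1) - A (j - 1 - 1) * stepWeight z P i (j - 1 - 1)) * z (i + 1) (j - 1 - 1) +
          A (j - 1 - 1) * (stepWeight z P i (j - 1 - 1) * z (i + 1) (j - 1 - 1)) by ring, hd3]
      exact O.mul_mem (O.add_mem (O.mul_mem (hj.2 h1) (hz _ _)) (O.mul_mem hA2 (O.mul_mem
        (O.mul_mem (hP _ _) (O.mul_mem (hz _ _) (hN i _ (by omega) h1).1)) (hz _ _)))) hw

lemma pathSum_mem_of_poleControlled (hn : 2 ≤ n) (e : K) (s : ℤ) (he : e ∈ O)
    (he' : e * (z 0 (s - 1) / z 0 s) ∈ O) :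
    z n (n - 1) * pathSum (stepWeight z P) e s n n ∈ O := by
  have key : ∀ i, i + 1 < n →
      PoleControlled O z P i (pathSum (stepWeight z P) e s (i + 1)) := by
    intro i
    induction i with
    | zero => exact fun _ => poleControlled_pathSum_one O n z P hz hz0 hP hU hN hn e s he he'
    | succ i ih => exact fun hi => (ih (by omega)).succ O n z P hz hz0 hP hU hN hE hi
  obtain ⟨m, rfl⟩ : ∃ m, n = m + 2 := ⟨n - 2, by omega⟩
  have h := (key m (by omega)).mul_step_mem O (m + 2) z P hz hz0 hP hU hN hE (by omega)
    (z (m + 2) (((m + 2 : ℕ) : ℤ) - 1)) (hz _ _) (((m + 2 : ℕ) : ℤ) - 1) (by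
      rw [mul_div_cancel₀ _ (hz0 _ _)]; exact hz _ _)
  rw [sub_add_cancel] at h
  rw [pathSum_succ]
  exact h

end Regularity

section RationalFunctions

/-- The subring of rational functions that are regular at `x`. -/
def regularAt (x : ℂ) : Subring (RatFunc ℂ) where
  carrier := {f | ∃ p q : Polynomial ℂ, q.eval x ≠ 0 ∧
    f = algebraMap (Polynomial ℂ) (RatFunc ℂ) p / algebraMap (Polynomial ℂ) (RatFunc ℂ) q}
  zero_mem' := ⟨0, 1, by simp, by simp⟩
  one_mem' := ⟨1, 1, by simp, by simp⟩
  mul_mem' := by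
    rintro _ _ ⟨p, q, hq, rfl⟩ ⟨p', q', hq', rfl⟩
    exact ⟨p * p', q * q', by simp [hq, hq'], by simp [div_mul_div_comm]⟩
  neg_mem' := by
    rintro _ ⟨p, q, hq, rfl⟩
    exact ⟨-p, q, hq, by rw [map_neg]; ring⟩
  add_mem' := by
    rintro _ _ ⟨p, q, hq, rfl⟩ ⟨p', q', hq', rfl⟩
    refine ⟨p * q' + q * p', q * q', by simp [hq, hq'], ?_⟩
    have h1 : algebraMap (Polynomial ℂ) (RatFunc ℂ) q ≠ 0 :=
      RatFunc.algebraMap_ne_zero (by rintro rfl; simp at hq)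
    have h2 : algebraMap (Polynomial ℂ) (RatFunc ℂ) q' ≠ 0 :=
      RatFunc.algebraMap_ne_zero (by rintro rfl; simp at hq')
    rw [div_add_div _ _ h1 h2]
    simp

lemma mem_regularAt {x : ℂ} {f : RatFunc ℂ} : f ∈ regularAt x ↔ ∃ p q : Polynomial ℂ,
    q.eval x ≠ 0 ∧
    f = algebraMap (Polynomial ℂ) (RatFunc ℂ) p / algebraMap (Polynomial ℂ) (RatFunc ℂ) q :=
  Iff.rfl

lemma algebraMap_mem_regularAt (x : ℂ) (p : Polynomial ℂ) :
    algebraMap (Polynomial ℂ) (RatFunc ℂ) p ∈ regularAt x :=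
  ⟨p, 1, by simp, by simp⟩

lemma inv_algebraMap_mem_regularAt_iff {x : ℂ} {p : Polynomial ℂ} (hp : p ≠ 0) :
    (algebraMap (Polynomial ℂ) (RatFunc ℂ) p)⁻¹ ∈ regularAt x ↔ p.eval x ≠ 0 := by
  constructor
  · rintro ⟨a, b, hb, h⟩ h0
    have hp' := RatFunc.algebraMap_ne_zero hp
    have hb' : algebraMap (Polynomial ℂ) (RatFunc ℂ) b ≠ 0 :=
      RatFunc.algebraMap_ne_zero (by rintro rfl; simp at hb)
    rw [inv_eq_one_div, div_eq_div_iff hp' hb', one_mul, ← map_mul] at h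
    have := RatFunc.algebraMap_injective ℂ h
    rw [this] at hb
    simp [h0] at hb
  · intro h
    exact ⟨1, p, h, by simp⟩

/-- A rational function that is regular everywhere is a polynomial. -/
lemma exists_polynomial_of_forall_mem_regularAt {f : RatFunc ℂ} (hf : ∀ x, f ∈ regularAt x) :
    ∃ p : Polynomial ℂ, f = algebraMap (Polynomial ℂ) (RatFunc ℂ) p := by
  have hd : IsUnit f.denom := by
    by_contra hu
    obtain ⟨x, hx⟩ := IsAlgClosed.exists_root f.denom
      (fun h => hu (isUnit_iff_degree_eq_zero.2 h))
    obtain ⟨p, q, hq, h⟩ := mem_regularAt.1 (hf x)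
    have hq' : algebraMap (Polynomial ℂ) (RatFunc ℂ) q ≠ 0 :=
      RatFunc.algebraMap_ne_zero (by rintro rfl; simp at hq)
    rw [← RatFunc.num_div_denom f,
      div_eq_div_iff (RatFunc.algebraMap_ne_zero f.denom_ne_zero) hq', ← map_mul, ← map_mul] at h
    have h1 := congrArg (eval x) (RatFunc.algebraMap_injective ℂ h)
    rw [eval_mul, eval_mul, hx.eq_zero, mul_zero] at h1
    have h2 : f.num.eval x = 0 := (mul_eq_zero.1 h1).resolve_right hq
    obtain ⟨a, b, hab⟩ := RatFunc.isCoprime_num_denom f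
    have := congrArg (eval x) hab
    simp [h2, hx.eq_zero] at this
  have h1 : f.denom = 1 := (RatFunc.monic_denom f).eq_one_of_isUnit hd
  exact ⟨f.num, by conv_lhs => rw [← RatFunc.num_div_denom f, h1, map_one, div_one]⟩

lemma comp_C_mul_X_ne_zero {c : ℂ} (hc : c ≠ 0) {p : Polynomial ℂ} (hp : p ≠ 0) :
    p.comp (C c * X) ≠ 0 := by
  intro h
  apply hp
  have : (p.comp (C c * X)).comp (C c⁻¹ * X) = p := by
    rw [comp_assoc]
    simp [← mul_assoc, ← C_mul, hc]
  rw [← this, h, zero_comp]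

lemma pshift_ne_zero {c : ℂ} (hc : c ≠ 0) {p : Polynomial ℂ} (hp : p ≠ 0) : pshift c p ≠ 0 :=
  RatFunc.algebraMap_ne_zero (comp_C_mul_X_ne_zero hc hp)

lemma pshift_mem_regularAt (x c : ℂ) (p : Polynomial ℂ) : pshift c p ∈ regularAt x :=
  algebraMap_mem_regularAt x _

lemma inv_pshift_mem_regularAt_iff {x c : ℂ} (hc : c ≠ 0) {p : Polynomial ℂ} (hp : p ≠ 0) :
    (pshift c p)⁻¹ ∈ regularAt x ↔ p.eval (c * x) ≠ 0 := by
  rw [pshift, inv_algebraMap_mem_regularAt_iff (comp_C_mul_X_ne_zero hc hp)]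
  simp

/-- The substitution `x ↦ c * x` as a ring homomorphism of rational functions. -/
def qshiftHom (c : ℂ) (hc : c ≠ 0) : RatFunc ℂ →+* RatFunc ℂ :=
  RatFunc.mapRingHom (compRingHom (C c * X)) (fun p hp => by
    rw [Submonoid.mem_comap]
    exact mem_nonZeroDivisors_of_ne_zero
      (comp_C_mul_X_ne_zero hc (nonZeroDivisors.ne_zero hp)))

lemma qshiftHom_apply (c : ℂ) (hc : c ≠ 0) (f : RatFunc ℂ) : qshiftHom c hc f = qshift c f := by
  rw [qshiftHom, RatFunc.coe_mapRingHom_eq_coe_map, RatFunc.map_apply]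
  rfl

lemma qshiftHom_pshift (c : ℂ) (hc : c ≠ 0) (c' : ℂ) (p : Polynomial ℂ) :
    qshiftHom c hc (pshift c' p) = pshift (c' * c) p := by
  have h := RatFunc.map_apply_div (compRingHom (C c * X)) (fun p hp => by
    rw [Submonoid.mem_comap]
    exact mem_nonZeroDivisors_of_ne_zero
      (comp_C_mul_X_ne_zero hc (nonZeroDivisors.ne_zero hp))) (p.comp (C c' * X)) 1
  simp only [map_one, div_one] at h
  rw [qshiftHom, RatFunc.coe_mapRingHom_eq_coe_map, pshift, h, pshift, coe_compRingHom_apply,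
    comp_assoc]
  simp [mul_assoc]

lemma pshift_one (p : Polynomial ℂ) : pshift 1 p = algebraMap (Polynomial ℂ) (RatFunc ℂ) p := by
  simp [pshift]

end RationalFunctions

section Bethe

variable (n : ℕ) (q1 q2 q3 : ℂ) (l : ZMod n → ℕ) (s : (ν : ZMod n) → Fin (l ν) → ℂ)
  (F G : ZMod n → Polynomial ℂ)

lemma yP_ne_zero (ν : ZMod n) : yP n l s ν ≠ 0 :=
  Finset.prod_ne_zero_iff.2 fun _ _ => X_sub_C_ne_zero _

lemma eval_yP_eq_zero_iff (ν : ZMod n) (x : ℂ) :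
    (yP n l s ν).eval x = 0 ↔ ∃ a, x = s ν a := by
  simp [yP, eval_prod, Finset.prod_eq_zero_iff, sub_eq_zero]

/-- Numerators vanishing at a zero of `y_ν(c x)` cancel its pole, when `y_ν` has simple roots. -/
lemma div_pshift_yP_mem_regularAt {ν : ZMod n} (hinj : Function.Injective (s ν)) {c x : ℂ}
    (hc : c ≠ 0) (hx : (yP n l s ν).eval (c * x) = 0) {N : Polynomial ℂ} (hN : N.eval x = 0) :
    algebraMap (Polynomial ℂ) (RatFunc ℂ) N / pshift c (yP n l s ν) ∈ regularAt x := by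
  obtain ⟨a, ha⟩ := (eval_yP_eq_zero_iff n l s ν _).1 hx
  obtain ⟨N', rfl⟩ := dvd_iff_isRoot.2 hN
  have hy : (yP n l s ν).comp (C c * X) = (X - C x) *
      (C c * ∏ b ∈ Finset.univ.erase a, (C c * X - C (s ν b))) := by
    rw [yP, Polynomial.prod_comp, ← Finset.mul_prod_erase _ _ (Finset.mem_univ a)]
    simp only [sub_comp, X_comp, C_comp]
    rw [← ha, C_mul]
    ring
  refine ⟨N', C c * ∏ b ∈ Finset.univ.erase a, (C c * X - C (s ν b)), ?_, ?_⟩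
  · simp only [eval_mul, eval_C, eval_prod, eval_sub, eval_X]
    refine mul_ne_zero hc (Finset.prod_ne_zero_iff.2 fun b hb => ?_)
    rw [ha, sub_ne_zero]
    exact fun h => Finset.ne_of_mem_erase hb (hinj h).symm
  · rw [pshift, hy, map_mul, map_mul (algebraMap _ _) (X - C x),
      mul_div_mul_left _ _ (RatFunc.algebraMap_ne_zero (X_sub_C_ne_zero x))]

/-- `y_i(q₁^{i-1} q₂^j x)`. -/
def yShift (i : ℕ) (j : ℤ) : RatFunc ℂ :=
  pshift (q1 ^ ((i : ℤ) - 1) * q2 ^ j) (yP n l s (i : ZMod n))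

/-- `∏_{1 ≤ ν ≤ j} F_ν(q₁^{ν-1} q₂^j x)`. -/
def FProd (j : ℤ) : RatFunc ℂ :=
  ∏ ν ∈ Finset.Icc 1 j.toNat, pshift (q1 ^ (ν - 1) * q2 ^ j) (F (ν : ZMod n))

/-- `∏_{1 ≤ ν ≤ i} Ψ̃_ν(q₁^{ν-1} q₂^j x)`. -/
def psiProd (i : ℕ) (j : ℤ) : RatFunc ℂ :=
  ∏ ν ∈ Finset.Icc 1 i, psiR n F G (ν : ZMod n) (q1 ^ (ν - 1) * q2 ^ j)

/-- The factor by which the path weights are rescaled. -/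
def gaugeFactor (j : ℤ) : RatFunc ℂ :=
  (∏ m ∈ Finset.range j.toNat, FProd n q1 q2 F m) / yShift n q1 q2 l s 0 (j - 1)

lemma qshift_bf (hq : q1 * q2 * q3 = 1) (i : ℕ) (j : ℤ) :
    qshift (q2 ^ (j - i)) (bf n q1 q2 q3 l s F G (i + 1)) =
      psiProd n q1 q2 F G i j * (yShift n q1 q2 l s i (j - 1) / yShift n q1 q2 l s i j) *
        (yShift n q1 q2 l s (i + 1) (j + 1) / yShift n q1 q2 l s (i + 1) j) *
        (yShift n q1 q2 l s 0 j / yShift n q1 q2 l s 0 (j - 1)) := by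
  have h1 : q1 ≠ 0 := by rintro rfl; simp at hq
  have h2 : q2 ≠ 0 := by rintro rfl; simp at hq
  have h3 : q3 = (q1 * q2)⁻¹ := eq_inv_of_mul_eq_one_right hq
  have hz : ∀ j, yShift n q1 q2 l s 0 j ≠ 0 := fun j =>
    pshift_ne_zero (mul_ne_zero (zpow_ne_zero _ h1) (zpow_ne_zero _ h2)) (yP_ne_zero n l s _)
  rw [← qshiftHom_apply _ (zpow_ne_zero _ h2)]
  rcases Nat.eq_zero_or_pos i with rfl | hi
  · have e1 := hz j
    have e2 := hz (j - 1)
    have : psiProd n q1 q2 F G 0 j *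
        (yShift n q1 q2 l s 0 (j - 1) / yShift n q1 q2 l s 0 j) *
        (yShift n q1 q2 l s 1 (j + 1) / yShift n q1 q2 l s 1 j) *
        (yShift n q1 q2 l s 0 j / yShift n q1 q2 l s 0 (j - 1)) =
        yShift n q1 q2 l s 1 (j + 1) / yShift n q1 q2 l s 1 j := by
      rw [psiProd, Finset.Icc_eq_empty (by simp), Finset.prod_empty]
      field_simp
    rw [zero_add, this, bf, if_pos rfl, ← pshift_one, map_div₀, qshiftHom_pshift,
      qshiftHom_pshift, yShift, yShift]
    congr 2
    · simp [zpow_add₀ h2, mul_comm]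
    · simp
    · simp
    · simp
  · rw [bf, if_neg (by omega)]
    simp only [map_mul, map_div₀, map_prod, psiR, qshiftHom_pshift, psiProd, yShift]
    have hpow : ∀ m : ℤ, q3 ^ m = q1 ^ (-m) * q2 ^ (-m) := fun m => by
      rw [h3, inv_zpow', mul_zpow]
    have hq3 : q3 = q1 ^ (-1 : ℤ) * q2 ^ (-1 : ℤ) := by rw [← hpow, zpow_one]
    congr 1
    · congr 1
      · congr 1
        · refine Finset.prod_congr rfl fun ν _ => ?_
          have : q1 ^ (ν - 1) * q2 ^ (i + 1 - 1) * q2 ^ (j - (i : ℤ)) = q1 ^ (ν - 1) * q2 ^ j := by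
            rw [mul_assoc, add_tsub_cancel_right, ← zpow_natCast q2, ← zpow_add₀ h2]
            congr 2; ring
          rw [this]
        · congr 2
          · rw [hpow, mul_assoc, ← zpow_add₀ h2]
            congr 2 <;> push_cast <;> ring
          · push_cast; ring_nf
          · rw [hpow, mul_assoc, mul_assoc, ← zpow_one_add₀ h2, ← zpow_add₀ h2]
            congr 2 <;> push_cast <;> ring
          · push_cast; ring_nf
      · congr 2
        · rw [hpow, mul_assoc, mul_assoc, ← zpow_one_add₀ h2, ← zpow_add₀ h2]
          congr 2 <;> push_cast <;> ring
        · rw [hpow, mul_assoc, ← zpow_add₀ h2]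
          congr 2 <;> push_cast <;> ring
    · congr 2
      · rw [hq3, mul_assoc, mul_assoc, ← zpow_natCast q2, ← zpow_add₀ h2, ← zpow_add₀ h2]
        congr 2; push_cast; ring
      · simp
      · rw [hq3, mul_assoc, mul_assoc, ← zpow_natCast q2, ← zpow_add₀ h2, ← zpow_add₀ h2]
        congr 2; push_cast; ring
      · simp

lemma tf_eq_pathSum {k : ℕ} :
    tf n q1 q2 q3 l s F G k =
      pathSum (fun i j => qshift (q2 ^ (j - i)) (bf n q1 q2 q3 l s F G (i + 1))) 1
        ((n : ℤ) - k) n n := by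
  have := sum_strictMono_eq_pathSum
    (fun i j => qshift (q2 ^ (j - i)) (bf n q1 q2 q3 l s F G (i + 1))) ((n : ℤ) - k) n k
  rw [sub_add_cancel] at this
  rw [← this, tf]
  refine Finset.sum_congr rfl fun v _ => Finset.prod_congr rfl fun p _ => ?_
  congr 2
  ring

lemma a0R_eq (hq : q1 * q2 * q3 = 1) :
    a0R n q1 q2 q3 l s F = (∏ m ∈ Finset.range n, FProd n q1 q2 F m) *
      (∏ j ∈ Finset.Icc 1 (n - 1), yShift n q1 q2 l s 0 ((j : ℤ) - 1)) *
      yShift n q1 q2 l s n ((n : ℤ) - 1) := by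
  have h1 : q1 ≠ 0 := by rintro rfl; simp at hq
  have h2 : q2 ≠ 0 := by rintro rfl; simp at hq
  have h3 : q3 = (q1 * q2)⁻¹ := eq_inv_of_mul_eq_one_right hq
  have hpow : ∀ m : ℤ, q3 ^ m = q1 ^ (-m) * q2 ^ (-m) := fun m => by
    rw [h3, inv_zpow', mul_zpow]
  rw [a0R]
  congr 1
  · congr 1
    · simp only [FProd]
      rw [Finset.prod_sigma']
      refine Finset.prod_bij' (fun p _ => ⟨p.2 - 1, p.1⟩) (fun p _ => (p.2, p.1 + 1)) ?_ ?_ ?_ ?_ ?_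
      · rintro ⟨a, b⟩ h
        simp at h ⊢
        omega
      · rintro ⟨a, b⟩ h
        simp at h ⊢
        omega
      · rintro ⟨a, b⟩ h
        simp at h ⊢
        omega
      · rintro ⟨a, b⟩ h
        simp
      · rintro ⟨a, b⟩ h
        simp only [zpow_natCast]
    · refine Finset.prod_congr rfl fun j _ => ?_
      have := hpow 1
      rw [zpow_one] at this
      rw [yShift, this, mul_assoc, ← zpow_natCast q2, ← zpow_add₀ h2, Nat.cast_zero,
        show -1 + (j : ℤ) = j - 1 by ring, show -(1 : ℤ) = ((0 : ℕ) : ℤ) - 1 by simp,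
        Nat.cast_zero, Nat.cast_zero]
  · rw [yShift, hpow, ZMod.natCast_self]
    congr 3 <;> ring

lemma inv_yShift_mem_iff (h1 : q1 ≠ 0) (h2 : q2 ≠ 0) (x : ℂ) (i : ℕ) (j : ℤ) :
    (yShift n q1 q2 l s i j)⁻¹ ∈ regularAt x ↔
      (yP n l s (i : ZMod n)).eval (q1 ^ ((i : ℤ) - 1) * q2 ^ j * x) ≠ 0 :=
  inv_pshift_mem_regularAt_iff (mul_ne_zero (zpow_ne_zero _ h1) (zpow_ne_zero _ h2))
    (yP_ne_zero n l s _)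

lemma yShift_ne_zero (h1 : q1 ≠ 0) (h2 : q2 ≠ 0) (i : ℕ) (j : ℤ) :
    yShift n q1 q2 l s i j ≠ 0 :=
  pshift_ne_zero (mul_ne_zero (zpow_ne_zero _ h1) (zpow_ne_zero _ h2)) (yP_ne_zero n l s _)

lemma yShift_mem (x : ℂ) (i : ℕ) (j : ℤ) : yShift n q1 q2 l s i j ∈ regularAt x :=
  pshift_mem_regularAt _ _ _

lemma FProd_mem (x : ℂ) (j : ℤ) : FProd n q1 q2 F j ∈ regularAt x :=
  Subring.prod_mem _ fun _ _ => pshift_mem_regularAt _ _ _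

lemma FProd_ne_zero (h1 : q1 ≠ 0) (h2 : q2 ≠ 0) (hF : ∀ ν, F ν ≠ 0) (j : ℤ) :
    FProd n q1 q2 F j ≠ 0 :=
  Finset.prod_ne_zero_iff.2 fun _ _ =>
    pshift_ne_zero (mul_ne_zero (pow_ne_zero _ h1) (zpow_ne_zero _ h2)) (hF _)

lemma psiProd_mul_FProd_mem (h1 : q1 ≠ 0) (h2 : q2 ≠ 0) (hF : ∀ ν, F ν ≠ 0) (x : ℂ) {i : ℕ}
    {j : ℤ} (hij : (i : ℤ) ≤ j) :
    psiProd n q1 q2 F G i j * FProd n q1 q2 F j ∈ regularAt x := by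
  have hsub : Finset.Icc 1 i ⊆ Finset.Icc 1 j.toNat := Finset.Icc_subset_Icc_right (by omega)
  rw [FProd, ← Finset.prod_sdiff hsub, mul_left_comm, psiProd, ← Finset.prod_mul_distrib]
  refine Subring.mul_mem _ (Subring.prod_mem _ fun _ _ => pshift_mem_regularAt _ _ _)
    (Subring.prod_mem _ fun ν _ => ?_)
  rw [psiR, div_mul_cancel₀ _
    (pshift_ne_zero (mul_ne_zero (pow_ne_zero _ h1) (zpow_ne_zero _ h2)) (hF _))]
  exact pshift_mem_regularAt _ _ _

/-- The weights of the rescaled path sum. -/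
def rescaledWeight : ℕ → ℤ → RatFunc ℂ :=
  stepWeight (yShift n q1 q2 l s) (fun i j => psiProd n q1 q2 F G i j * FProd n q1 q2 F j)

lemma gaugeFactor_ne_zero (h1 : q1 ≠ 0) (h2 : q2 ≠ 0) (hF : ∀ ν, F ν ≠ 0) (j : ℤ) :
    gaugeFactor n q1 q2 l s F j ≠ 0 :=
  div_ne_zero (Finset.prod_ne_zero_iff.2 fun _ _ => FProd_ne_zero n q1 q2 F h1 h2 hF _)
    (yShift_ne_zero n q1 q2 l s h1 h2 _ _)

lemma rescaledWeight_eq (hq : q1 * q2 * q3 = 1) (hF : ∀ ν, F ν ≠ 0) (i : ℕ) {j : ℤ}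
    (hj : 0 ≤ j) :
    rescaledWeight n q1 q2 l s F G i j =
      qshift (q2 ^ (j - i)) (bf n q1 q2 q3 l s F G (i + 1)) *
        (gaugeFactor n q1 q2 l s F (j + 1) / gaugeFactor n q1 q2 l s F j) := by
  have h1 : q1 ≠ 0 := by rintro rfl; simp at hq
  have h2 : q2 ≠ 0 := by rintro rfl; simp at hq
  have e1 := yShift_ne_zero n q1 q2 l s h1 h2 0 j
  have e2 := yShift_ne_zero n q1 q2 l s h1 h2 0 (j - 1)
  have e3 := yShift_ne_zero n q1 q2 l s h1 h2 i j
  have e4 := yShift_ne_zero n q1 q2 l s h1 h2 (i + 1) j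
  have e5 : ∏ m ∈ Finset.range j.toNat, FProd n q1 q2 F m ≠ 0 :=
    Finset.prod_ne_zero_iff.2 fun _ _ => FProd_ne_zero n q1 q2 F h1 h2 hF _
  rw [qshift_bf n q1 q2 q3 l s F G hq, rescaledWeight, stepWeight, gaugeFactor, gaugeFactor,
    show (j + 1).toNat = j.toNat + 1 by omega, Finset.prod_range_succ, Int.toNat_of_nonneg hj,
    add_sub_cancel_right]
  field_simp

/-- The weight of the starting point of the rescaled path sum. -/
def startWeight (k : ℕ) : RatFunc ℂ :=
  ((∏ m ∈ Finset.range n, FProd n q1 q2 F m) *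
    ∏ j ∈ Finset.Icc 1 (n - 1), yShift n q1 q2 l s 0 ((j : ℤ) - 1)) *
    (gaugeFactor n q1 q2 l s F ((n : ℤ) - k) / gaugeFactor n q1 q2 l s F n)

lemma aR_eq_pathSum (hq : q1 * q2 * q3 = 1) (hF : ∀ ν, F ν ≠ 0) {k : ℕ} (hk : k ≤ n) :
    aR n q1 q2 q3 l s F G k = yShift n q1 q2 l s n ((n : ℤ) - 1) *
      pathSum (rescaledWeight n q1 q2 l s F G) (startWeight n q1 q2 l s F k)
        ((n : ℤ) - k) n n := by
  have h1 : q1 ≠ 0 := by rintro rfl; simp at hq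
  have h2 : q2 ≠ 0 := by rintro rfl; simp at hq
  have hg := gaugeFactor_ne_zero n q1 q2 l s F h1 h2 hF
  rw [aR, a0R_eq n q1 q2 q3 l s F hq, tf_eq_pathSum,
    pathSum_gauge _ (rescaledWeight n q1 q2 l s F G) (gaugeFactor n q1 q2 l s F) _ _ hg
      (fun i j hj => rescaledWeight_eq n q1 q2 q3 l s F G hq hF i (by omega)), startWeight]
  have e1 := hg n
  have e2 := hg ((n : ℤ) - k)
  field_simp

lemma startWeight_eq (hn : 2 ≤ n) (h1 : q1 ≠ 0) (h2 : q2 ≠ 0) (hF : ∀ ν, F ν ≠ 0) (k : ℕ) :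
    startWeight n q1 q2 l s F k =
      (∏ m ∈ Finset.range ((n : ℤ) - k).toNat, FProd n q1 q2 F m) *
        ((∏ j ∈ Finset.Icc 1 n, yShift n q1 q2 l s 0 ((j : ℤ) - 1)) /
          yShift n q1 q2 l s 0 ((n : ℤ) - k - 1)) := by
  obtain ⟨m, rfl⟩ : ∃ m, n = m + 1 := ⟨n - 1, by omega⟩
  rw [startWeight, gaugeFactor, gaugeFactor, ← Finset.insert_Icc_right_eq_Icc_add_one (by omega),
    Finset.prod_insert (by simp), Int.toNat_natCast, add_tsub_cancel_right]
  have e1 : ∏ i ∈ Finset.range (m + 1), FProd (m + 1) q1 q2 F i ≠ 0 :=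
    Finset.prod_ne_zero_iff.2 fun _ _ => FProd_ne_zero (m + 1) q1 q2 F h1 h2 hF _
  have e2 := yShift_ne_zero (m + 1) q1 q2 l s h1 h2 0 (((m + 1 : ℕ) : ℤ) - 1)
  have e3 := yShift_ne_zero (m + 1) q1 q2 l s h1 h2 0 (((m + 1 : ℕ) : ℤ) - k - 1)
  field_simp

lemma prod_yShift_div_mem (h1 : q1 ≠ 0) (h2 : q2 ≠ 0) (x : ℂ) {j : ℤ} (hj : 0 ≤ j)
    (hjn : j < n) :
    (∏ m ∈ Finset.Icc 1 n, yShift n q1 q2 l s 0 ((m : ℤ) - 1)) / yShift n q1 q2 l s 0 j ∈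
      regularAt x := by
  have hmem : j.toNat + 1 ∈ Finset.Icc 1 n := by simp; omega
  rw [← Finset.mul_prod_erase _ _ hmem, show ((j.toNat + 1 : ℕ) : ℤ) - 1 = j by omega,
    mul_div_cancel_left₀ _ (yShift_ne_zero n q1 q2 l s h1 h2 0 j)]
  exact Subring.prod_mem _ fun _ _ => yShift_mem n q1 q2 l s x _ _

lemma startWeight_mem (hn : 2 ≤ n) (h1 : q1 ≠ 0) (h2 : q2 ≠ 0) (hF : ∀ ν, F ν ≠ 0) (x : ℂ)
    {k : ℕ} (hk0 : 0 < k) (hk : k < n) : startWeight n q1 q2 l s F k ∈ regularAt x := by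
  rw [startWeight_eq n q1 q2 l s F hn h1 h2 hF]
  exact Subring.mul_mem _ (Subring.prod_mem _ fun _ _ => FProd_mem n q1 q2 F x _)
    (prod_yShift_div_mem n q1 q2 l s h1 h2 x (by omega) (by omega))

lemma startWeight_mul_mem (hn : 2 ≤ n) (h1 : q1 ≠ 0) (h2 : q2 ≠ 0) (hF : ∀ ν, F ν ≠ 0) (x : ℂ)
    {k : ℕ} (hk0 : 0 < k) (hk : k ≤ n) :
    startWeight n q1 q2 l s F k * (yShift n q1 q2 l s 0 ((n : ℤ) - k - 1) /
      yShift n q1 q2 l s 0 ((n : ℤ) - k)) ∈ regularAt x := by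
  have e := yShift_ne_zero n q1 q2 l s h1 h2 0 ((n : ℤ) - k - 1)
  rw [startWeight_eq n q1 q2 l s F hn h1 h2 hF, mul_assoc, div_mul_div_cancel₀ e]
  exact Subring.mul_mem _ (Subring.prod_mem _ fun _ _ => FProd_mem n q1 q2 F x _)
    (prod_yShift_div_mem n q1 q2 l s h1 h2 x (by omega) (by omega))

/-- The consequences of the Bethe ansatz equation at a zero of `y_{i+1}(q₁^i q₂^j x)`. -/
lemma stepWeight_add_mem (hq : q1 * q2 * q3 = 1)
    (hinj : ∀ ν, Function.Injective (s ν)) (hF : ∀ ν, F ν ≠ 0)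
    (hreg : ∀ (μ ν : ZMod n) (a : Fin (l ν)) (i j : ℤ),
      (F μ).eval (q1 ^ i * q2 ^ j * s ν a) ≠ 0 ∧ (G μ).eval (q1 ^ i * q2 ^ j * s ν a) ≠ 0)
    (hBAE : ∀ ν : ZMod n, ν ≠ 0 → ∀ i : Fin (l ν), BAE n q1 q2 q3 l s F G ν (s ν i))
    {x : ℂ} {i : ℕ} {j : ℤ} (hi : i + 1 < n)
    (hP : psiProd n q1 q2 F G i j * FProd n q1 q2 F j ∈ regularAt x)
    (hx : (yShift n q1 q2 l s (i + 1) j)⁻¹ ∉ regularAt x) :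
    ((yShift n q1 q2 l s i j)⁻¹ ∈ regularAt x ∧
      (yShift n q1 q2 l s i (j - 1))⁻¹ ∈ regularAt x) ∧
    rescaledWeight n q1 q2 l s F G i j + rescaledWeight n q1 q2 l s F G (i + 1) j ∈
      regularAt x := by
  have h1 : q1 ≠ 0 := by rintro rfl; simp at hq
  have h2 : q2 ≠ 0 := by rintro rfl; simp at hq
  have h3 : q3 = q1⁻¹ * q2⁻¹ := by rw [eq_inv_of_mul_eq_one_right hq, mul_inv]
  have h3' : q3⁻¹ = q1 * q2 := by rw [h3, mul_inv, inv_inv, inv_inv]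
  have hν : ((i + 1 : ℕ) : ZMod n) ≠ 0 := fun h => by
    have := Nat.le_of_dvd (by omega) ((ZMod.natCast_eq_zero_iff _ _).1 h)
    omega
  have hx' := hx
  rw [inv_yShift_mem_iff n q1 q2 l s h1 h2, not_not] at hx'
  obtain ⟨a, ha⟩ := (eval_yP_eq_zero_iff n l s _ _).1 hx'
  have hb := hBAE _ hν a
  have hc0 : q1 ^ i * q2 ^ j ≠ 0 := mul_ne_zero (pow_ne_zero _ h1) (zpow_ne_zero _ h2)
  have hFs : (F (i + 1 : ℕ)).eval (s (i + 1 : ℕ) a) ≠ 0 := by simpa using (hreg _ _ a 0 0).1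
  have hGs : (G (i + 1 : ℕ)).eval (s (i + 1 : ℕ) a) ≠ 0 := by simpa using (hreg _ _ a 0 0).2
  have hs : s (i + 1 : ℕ) a = q1 ^ i * q2 ^ j * x := by
    rw [← ha]; congr 2; push_cast; rw [add_sub_cancel_right, zpow_natCast]
  have hm : ((i + 1 : ℕ) : ZMod n) - 1 = (i : ℕ) := by push_cast; ring
  have hp : ((i + 1 : ℕ) : ZMod n) + 1 = (i + 1 + 1 : ℕ) := by push_cast; ring
  have t1 : q2 * s (i + 1 : ℕ) a = q1 ^ (((i + 1 : ℕ) : ℤ) - 1) * q2 ^ (j + 1) * x := by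
    rw [hs, zpow_add_one₀ h2]; push_cast; rw [add_sub_cancel_right, zpow_natCast]; ring
  have t2 : q2⁻¹ * s (i + 1 : ℕ) a = q1 ^ (((i + 1 : ℕ) : ℤ) - 1) * q2 ^ (j - 1) * x := by
    rw [hs, zpow_sub_one₀ h2]; push_cast; rw [add_sub_cancel_right, zpow_natCast]; ring
  have t3 : q3 * s (i + 1 : ℕ) a = q1 ^ ((i : ℤ) - 1) * q2 ^ (j - 1) * x := by
    rw [hs, h3, zpow_sub_one₀ h2, zpow_sub_one₀ h1, zpow_natCast]; ring
  have t4 : q1⁻¹ * s (i + 1 : ℕ) a = q1 ^ ((i : ℤ) - 1) * q2 ^ j * x := by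
    rw [hs, zpow_sub_one₀ h1, zpow_natCast]; ring
  have t5 : q1 * s (i + 1 : ℕ) a = q1 ^ (((i + 1 + 1 : ℕ) : ℤ) - 1) * q2 ^ j * x := by
    rw [hs]; push_cast; rw [add_sub_cancel_right, zpow_add_one₀ h1, zpow_natCast]; ring
  have t6 : q3⁻¹ * s (i + 1 : ℕ) a =
      q1 ^ (((i + 1 + 1 : ℕ) : ℤ) - 1) * q2 ^ (j + 1) * x := by
    rw [hs, h3', zpow_add_one₀ h2]; push_cast
    rw [add_sub_cancel_right, zpow_add_one₀ h1, zpow_natCast]; ring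
  rw [BAE, hm, hp, t1, t2, t3, t4, t5, t6] at hb
  have hne : -((G (i + 1 : ℕ)).eval (s (i + 1 : ℕ) a) / (F (i + 1 : ℕ)).eval (s (i + 1 : ℕ) a))
      ≠ 0 := neg_ne_zero.2 (div_ne_zero hGs hFs)
  rw [← hb] at hne
  simp only [ne_eq, mul_eq_zero, div_eq_zero_iff, not_or] at hne
  obtain ⟨⟨⟨n1, n2⟩, n3, n4⟩, n5, n6⟩ := hne
  have m4 := (inv_yShift_mem_iff n q1 q2 l s h1 h2 x i j).2 n4
  have m3 := (inv_yShift_mem_iff n q1 q2 l s h1 h2 x i (j - 1)).2 n3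
  have m5 := (inv_yShift_mem_iff n q1 q2 l s h1 h2 x (i + 1 + 1) j).2 n5
  refine ⟨⟨m4, m3⟩, ?_⟩
  have mF : (pshift (q1 ^ i * q2 ^ j) (F (i + 1 : ℕ)))⁻¹ ∈ regularAt x :=
    (inv_pshift_mem_regularAt_iff hc0 (hF _)).2 (by rwa [← hs])
  have eF := pshift_ne_zero hc0 (hF (i + 1 : ℕ))
  have e1 := yShift_ne_zero n q1 q2 l s h1 h2 i j
  have e2 := yShift_ne_zero n q1 q2 l s h1 h2 (i + 1) j
  have e3 := yShift_ne_zero n q1 q2 l s h1 h2 (i + 1 + 1) j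
  have hnum : (pshift (q1 ^ i * q2 ^ j) (F (i + 1 : ℕ)) * yShift n q1 q2 l s i (j - 1) *
        yShift n q1 q2 l s (i + 1 + 1) j * yShift n q1 q2 l s (i + 1) (j + 1) +
      pshift (q1 ^ i * q2 ^ j) (G (i + 1 : ℕ)) * yShift n q1 q2 l s (i + 1) (j - 1) *
        yShift n q1 q2 l s (i + 1 + 1) (j + 1) * yShift n q1 q2 l s i j) /
      yShift n q1 q2 l s (i + 1) j ∈ regularAt x := by
    simp only [yShift]
    conv in _ + _ => simp only [pshift, ← map_mul, ← map_add]
    refine div_pshift_yP_mem_regularAt n l s (hinj _)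
      (mul_ne_zero (zpow_ne_zero _ h1) (zpow_ne_zero _ h2)) hx' ?_
    simp only [eval_add, eval_mul, eval_comp, eval_C, eval_X, ← hs]
    rw [div_mul_div_comm, div_mul_div_comm, ← neg_div,
      div_eq_div_iff (mul_ne_zero (mul_ne_zero n2 n4) n6) hFs] at hb
    linear_combination hb
  have hsum : rescaledWeight n q1 q2 l s F G i j + rescaledWeight n q1 q2 l s F G (i + 1) j =
      (psiProd n q1 q2 F G i j * FProd n q1 q2 F j) *
      ((pshift (q1 ^ i * q2 ^ j) (F (i + 1 : ℕ)))⁻¹ * (yShift n q1 q2 l s i j)⁻¹ *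
        (yShift n q1 q2 l s (i + 1 + 1) j)⁻¹) *
      ((pshift (q1 ^ i * q2 ^ j) (F (i + 1 : ℕ)) * yShift n q1 q2 l s i (j - 1) *
        yShift n q1 q2 l s (i + 1 + 1) j * yShift n q1 q2 l s (i + 1) (j + 1) +
      pshift (q1 ^ i * q2 ^ j) (G (i + 1 : ℕ)) * yShift n q1 q2 l s (i + 1) (j - 1) *
        yShift n q1 q2 l s (i + 1 + 1) (j + 1) * yShift n q1 q2 l s i j) /
      yShift n q1 q2 l s (i + 1) j) := by
    have hpsi : psiProd n q1 q2 F G (i + 1) j = psiProd n q1 q2 F G i j *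
        (pshift (q1 ^ i * q2 ^ j) (G (i + 1 : ℕ)) / pshift (q1 ^ i * q2 ^ j) (F (i + 1 : ℕ))) := by
      rw [psiProd, Finset.prod_Icc_succ_top (by omega), add_tsub_cancel_right]
      rfl
    simp only [rescaledWeight, stepWeight, hpsi]
    field_simp
  rw [hsum]
  exact Subring.mul_mem _ (Subring.mul_mem _ hP (Subring.mul_mem _ (Subring.mul_mem _ mF m4) m5))
    hnum

end Bethe

/-- under the Bethe ansatz equations (BAE)_ν, `1 ≤ ν ≤ n−1`, each
`a_k(x) = a_0(x) t_k(x)`, `0 ≤ k ≤ n`, is a polynomial. -/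
theorem aR_is_polynomial
    (n : ℕ) (hn : 2 ≤ n) (q1 q2 q3 : ℂ) (hq : q1 * q2 * q3 = 1)
    (hgen : ∀ a b : ℤ, q1 ^ a * q2 ^ b = 1 → a = 0 ∧ b = 0)
    (l : ZMod n → ℕ) (s : (ν : ZMod n) → Fin (l ν) → ℂ)
    (hs0 : ∀ ν i, s ν i ≠ 0)
    (F G : ZMod n → Polynomial ℂ)
    (hcop : ∀ ν, IsCoprime (F ν) (G ν)) (hmon : ∀ ν, (F ν).Monic)
    (hsep : ∀ (μ ν : ZMod n) (i : Fin (l μ)) (j : Fin (l ν)) (m : ℤ),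
      s μ i = q2 ^ m * s ν j → μ = ν ∧ (i : ℕ) = (j : ℕ))
    (hreg : ∀ (μ ν : ZMod n) (a : Fin (l ν)) (i j : ℤ),
      (F μ).eval (q1 ^ i * q2 ^ j * s ν a) ≠ 0 ∧ (G μ).eval (q1 ^ i * q2 ^ j * s ν a) ≠ 0)
    (hBAE : ∀ ν : ZMod n, ν ≠ 0 → ∀ i : Fin (l ν), BAE n q1 q2 q3 l s F G ν (s ν i)) :
    ∀ k : ℕ, k ≤ n → ∃ p : Polynomial ℂ,
      aR n q1 q2 q3 l s F G k = algebraMap (Polynomial ℂ) (RatFunc ℂ) p := by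
  intro k hk
  have h1 : q1 ≠ 0 := by rintro rfl; simp at hq
  have h2 : q2 ≠ 0 := by rintro rfl; simp at hq
  have hF : ∀ ν, F ν ≠ 0 := fun ν => (hmon ν).ne_zero
  have hinj : ∀ ν, Function.Injective (s ν) := fun ν a b hab =>
    Fin.ext (hsep ν ν a b 0 (by simpa using hab)).2
  refine exists_polynomial_of_forall_mem_regularAt fun x => ?_
  rcases Nat.eq_zero_or_pos k with rfl | hk0
  · rw [aR, a0R_eq n q1 q2 q3 l s F hq, tf_eq_pathSum, Nat.cast_zero, sub_zero, pathSum_self,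
      mul_one]
    exact Subring.mul_mem _ (Subring.mul_mem _
      (Subring.prod_mem _ fun _ _ => FProd_mem n q1 q2 F x _)
      (Subring.prod_mem _ fun _ _ => yShift_mem n q1 q2 l s x _ _))
      (yShift_mem n q1 q2 l s x _ _)
  rw [aR_eq_pathSum n q1 q2 q3 l s F G hq hF hk]
  have hz := yShift_mem n q1 q2 l s x
  have hz0 := yShift_ne_zero n q1 q2 l s h1 h2
  have hP : ∀ (i : ℕ) (j : ℤ), (i : ℤ) ≤ j →
      psiProd n q1 q2 F G i j * FProd n q1 q2 F j ∈ regularAt x := fun i j hij =>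
    psiProd_mul_FProd_mem n q1 q2 F G h1 h2 hF x hij
  have hstart := startWeight_mul_mem n q1 q2 l s F hn h1 h2 hF x hk0 hk
  rcases hk.eq_or_lt with rfl | hkn
  · obtain ⟨m, rfl⟩ : ∃ m, k = m + 1 := ⟨k - 1, by omega⟩
    rw [sub_self, zero_sub] at hstart
    obtain ⟨Q, hQ, h⟩ := pathSum_diagonal (regularAt x) (yShift (m + 1) q1 q2 l s) _ hz0 hP _
      hstart m
    rw [sub_self, rescaledWeight]
    push_cast
    rw [h, add_sub_cancel_right, mul_left_comm, mul_div_cancel₀ _ (hz0 _ _)]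
    exact Subring.mul_mem _ hQ (hz _ _)
  have hstart' := startWeight_mem n q1 q2 l s F hn h1 h2 hF x hk0 hkn
  by_cases hu : ∀ i j, i + 1 < n → (yShift n q1 q2 l s (i + 1) j)⁻¹ ∈ regularAt x
  · exact pathSum_mem_of_units (regularAt x) n _ _ hn hz hz0 hP hu _ _ (by omega) hstart' hstart
  push Not at hu
  obtain ⟨i₀, j₀, _, hx⟩ := hu
  rw [inv_yShift_mem_iff n q1 q2 l s h1 h2, not_not] at hx
  obtain ⟨a, ha⟩ := (eval_yP_eq_zero_iff n l s _ _).1 hx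
  have hP' : ∀ (i : ℕ) (j : ℤ),
      psiProd n q1 q2 F G i j * FProd n q1 q2 F j ∈ regularAt x := fun i j => by
    refine Subring.mul_mem _ (Subring.prod_mem _ fun ν _ => ?_) (FProd_mem n q1 q2 F x _)
    rw [psiR, div_eq_mul_inv]
    refine Subring.mul_mem _ (pshift_mem_regularAt _ _ _)
      ((inv_pshift_mem_regularAt_iff (mul_ne_zero (pow_ne_zero _ h1) (zpow_ne_zero _ h2))
        (hF _)).2 ?_)
    have hr := (hreg ν _ a (((ν - 1 : ℕ) : ℤ) - (((i₀ + 1 : ℕ) : ℤ) - 1)) (j - j₀)).1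
    rw [← ha, zpow_sub₀ h1, zpow_sub₀ h2, zpow_natCast] at hr
    convert hr using 2
    have := zpow_ne_zero (((i₀ + 1 : ℕ) : ℤ) - 1) h1
    have := zpow_ne_zero j₀ h2
    field_simp
  have hBA := fun (i : ℕ) (j : ℤ) (hi : i + 1 < n) =>
    stepWeight_add_mem n q1 q2 q3 l s F G hq hinj hF hreg hBAE (x := x) hi (hP' i j)
  refine pathSum_mem_of_poleControlled (regularAt x) n _ _ hz hz0 hP' ?_
    (fun i j hi h => (hBA i j hi h).1) (fun i j hi h => (hBA i j hi h).2) hn _ _ hstart' hstart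
  intro i j j' _ hj hj'
  rw [inv_yShift_mem_iff n q1 q2 l s h1 h2, not_not] at hj hj'
  obtain ⟨b, hb⟩ := (eval_yP_eq_zero_iff n l s _ _).1 hj
  obtain ⟨b', hb'⟩ := (eval_yP_eq_zero_iff n l s _ _).1 hj'
  have hbb : s (i + 1 : ℕ) b = q2 ^ (j - j') * s (i + 1 : ℕ) b' := by
    rw [← hb, ← hb', zpow_sub₀ h2]
    have := zpow_ne_zero j' h2
    field_simp
  obtain rfl : b = b' := Fin.ext (hsep _ _ b b' _ hbb).2
  have h := (hgen 0 (j - j') (by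
    have h0 := hs0 _ b
    rw [zpow_zero, one_mul]
    exact mul_right_cancel₀ h0 (by rw [← hbb, one_mul]))).2
  omega

end
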